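/- A 6×6 complex Hadamard matrix h has the property that for every pair of distinct rows i₁ ≠ i₂ the multiset { h_{i₁k}·conj(h_{i₂k}) : 1 ≤ k ≤ 6 } equals { x, −x, y, −y, z, −z } for some unimodular x, y, z, if and only if h is equivalent to the Haagerup matrix H^q for some complex number q of modulus 1. -/

import Mathlib

/-- The primitive cube root of unity `j = exp(2πi/3)`. -/
noncomputable def ω : ℂ := Complex.exp (2 * Real.pi * Complex.I / 3)

/-- The multiset of entrywise products `h i₁ k * conj (h i₂ k)` of two rows of `h`. -/
def rowProd {m n : ℕ} (h : Matrix (Fin m) (Fin n) ℂ) (i₁ i₂ : Fin m) : Multiset ℂ :=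
  Multiset.map (fun k => h i₁ k * (starRingEnd ℂ) (h i₂ k)) Finset.univ.val

/-- The pair of rows `(i₁, i₂)` is binary: the multiset of entrywise products is
`{x, -x, y, -y, z, -z}` for some unimodular `x, y, z`. -/
def BinaryPair {m n : ℕ} (h : Matrix (Fin m) (Fin n) ℂ) (i₁ i₂ : Fin m) : Prop :=
  ∃ x y z : ℂ, ‖x‖ = 1 ∧ ‖y‖ = 1 ∧ ‖z‖ = 1 ∧
    rowProd h i₁ i₂ = {x, -x, y, -y, z, -z}

/-- The pair of rows `(i₁, i₂)` is ternary: the multiset of entrywise products is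
`{x, jx, j²x, y, jy, j²y}` for some unimodular `x, y`. -/
def TernaryPair {m n : ℕ} (h : Matrix (Fin m) (Fin n) ℂ) (i₁ i₂ : Fin m) : Prop :=
  ∃ x y : ℂ, ‖x‖ = 1 ∧ ‖y‖ = 1 ∧
    rowProd h i₁ i₂ = {x, ω * x, ω ^ 2 * x, y, ω * y, ω ^ 2 * y}

/-- Hadamard equivalence: `k` is obtained from `h` by permuting rows and columns and
multiplying rows and columns by unimodular scalars. -/
def MatEquiv {m n : ℕ} (h k : Matrix (Fin m) (Fin n) ℂ) : Prop :=
  ∃ (σ : Equiv.Perm (Fin m)) (τ : Equiv.Perm (Fin n)) (a : Fin m → ℂ) (b : Fin n → ℂ),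
    (∀ i, ‖a i‖ = 1) ∧ (∀ j, ‖b j‖ = 1) ∧
    ∀ i j, k i j = a i * b j * h (σ i) (τ j)

/-- `h` is a complex Hadamard matrix: unimodular entries and pairwise orthogonal rows. -/
def IsCHM {n : ℕ} (h : Matrix (Fin n) (Fin n) ℂ) : Prop :=
  (∀ i j, ‖h i j‖ = 1) ∧
  ∀ i₁ i₂, i₁ ≠ i₂ → ∑ k, h i₁ k * (starRingEnd ℂ) (h i₂ k) = 0

/-- The Haagerup matrix `H^q`. -/
noncomputable def HaagM (q : ℂ) : Matrix (Fin 6) (Fin 6) ℂ :=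
  !![1, 1,          1,                  1,                   1,         1;
     1, -1,         Complex.I,          Complex.I,           -Complex.I, -Complex.I;
     1, Complex.I,  -1,                 -Complex.I,          q,          -q;
     1, Complex.I,  -Complex.I,         -1,                  -q,         q;
     1, -Complex.I, (starRingEnd ℂ) q,  -(starRingEnd ℂ) q,  Complex.I,  -1;
     1, -Complex.I, -(starRingEnd ℂ) q, (starRingEnd ℂ) q,   -1,         Complex.I]

def F4 (a b c d : ℂ) : Prop := (a+b=0∧c+d=0) ∨ (a+c=0∧b+d=0) ∨ (a+d=0∧b+c=0)
def M15 (a b c d e f : ℂ) : Prop := (a+b=0 ∧ F4 c d e f) ∨ (a+c=0 ∧ F4 b d e f) ∨ (a+d=0 ∧ F4 b c e f)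
  ∨ (a+e=0 ∧ F4 b c d f) ∨ (a+f=0 ∧ F4 b c d e)

lemma four (a b c d : ℂ) (ha : ‖a‖=1) (hb : ‖b‖=1) (hc : ‖c‖=1) (hd : ‖d‖=1) (h : a+b+c+d=0) :
  F4 a b c d := by
  have key : ∀ z : ℂ, ‖z‖=1 → z * (starRingEnd ℂ) z = 1 := by
    intro z hz; rw [Complex.mul_conj, Complex.normSq_eq_norm_sq, hz]; simp
  have h2 : (starRingEnd ℂ) a + (starRingEnd ℂ) b + (starRingEnd ℂ) c + (starRingEnd ℂ) d = 0 := by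
    rw [← map_add, ← map_add, ← map_add, h, map_zero]
  have h3 : (a+b)*((a+c)*(a+d)) = 0 := by
    linear_combination a^2*h + a*b*c*d*h2 - b*c*d*key a ha - a*c*d*key b hb - a*b*d*key c hc - a*b*c*key d hd
  unfold F4
  rcases mul_eq_zero.1 h3 with h3 | h3
  · exact Or.inl ⟨h3, by linear_combination h - h3⟩
  rcases mul_eq_zero.1 h3 with h3 | h3
  · exact Or.inr (Or.inl ⟨h3, by linear_combination h - h3⟩)
  · exact Or.inr (Or.inr ⟨h3, by linear_combination h - h3⟩)

set_option maxHeartbeats 4000000 in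
lemma lemA (a b c s0 s1 s2 s3 s4 s5 : ℂ) (ha : a ≠ 0) (hb : b≠0) (hc : c≠0)
  (h0 : s0 ≠ 0) (h1 : s1 ≠ 0) (h2 : s2 ≠ 0) (h3 : s3 ≠ 0) (h4 : s4 ≠ 0) (h5 : s5 ≠ 0)
  (hs : M15 s0 s1 s2 s3 s4 s5) (ht : M15 (a*s0) (-a*s1) (b*s2) (-b*s3) (c*s4) (-c*s5)) :
  (a^2+b^2=0) ∨ (b^2+c^2=0) ∨ (a^2+c^2=0) := by
  by_contra hcon
  push Not at hcon
  obtain ⟨n1,n2,n3⟩ := hcon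
  unfold M15 F4 at hs ht
  rcases hs with ⟨e1, ⟨e2, e3⟩ | ⟨e2, e3⟩ | ⟨e2, e3⟩⟩ | ⟨e1, ⟨e2, e3⟩ | ⟨e2, e3⟩ | ⟨e2, e3⟩⟩ | ⟨e1, ⟨e2, e3⟩ | ⟨e2, e3⟩ | ⟨e2, e3⟩⟩ | ⟨e1, ⟨e2, e3⟩ | ⟨e2, e3⟩ | ⟨e2, e3⟩⟩ | ⟨e1, ⟨e2, e3⟩ | ⟨e2, e3⟩ | ⟨e2, e3⟩⟩ <;>
  (rw [add_comm] at e1 e2 e3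
   replace e1 := eq_neg_of_add_eq_zero_left e1
   replace e2 := eq_neg_of_add_eq_zero_left e2
   replace e3 := eq_neg_of_add_eq_zero_left e3
   subst e1 e2 e3
   rcases ht with ⟨f1, ⟨f2, f3⟩ | ⟨f2, f3⟩ | ⟨f2, f3⟩⟩ | ⟨f1, ⟨f2, f3⟩ | ⟨f2, f3⟩ | ⟨f2, f3⟩⟩ | ⟨f1, ⟨f2, f3⟩ | ⟨f2, f3⟩ | ⟨f2, f3⟩⟩ | ⟨f1, ⟨f2, f3⟩ | ⟨f2, f3⟩ | ⟨f2, f3⟩⟩ | ⟨f1, ⟨f2, f3⟩ | ⟨f2, f3⟩ | ⟨f2, f3⟩⟩ <;> grind)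

set_option maxHeartbeats 4000000 in
lemma lemB (a b c s0 s1 s2 s3 s4 s5 : ℂ) (ha : a ≠ 0) (hb : b≠0) (hc : c≠0)
  (h0 : s0 ≠ 0) (h1 : s1 ≠ 0) (h2 : s2 ≠ 0) (h3 : s3 ≠ 0) (h4 : s4 ≠ 0) (h5 : s5 ≠ 0)
  (hs : M15 s0 s1 s2 s3 s4 s5) (ht : M15 (a*s0) (-a*s1) (b*s2) (-b*s3) (c*s4) (-c*s5)) 
  (hr : b^2+c^2=0) (hr' : a^4 ≠ b^4) (hO : 2 * s0^2 = s0^2+s1^2+s2^2+s3^2+s4^2+s5^2)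
  (hs' : ¬ (s1^4=s0^4 ∧ s2^4=s0^4 ∧ s3^4=s0^4 ∧ s4^4=s0^4 ∧ s5^4=s0^4)) 
  (ht' : ¬ ((-a*s1)^4=(a*s0)^4 ∧ (b*s2)^4=(a*s0)^4 ∧ (-b*s3)^4=(a*s0)^4 ∧ (c*s4)^4=(a*s0)^4 ∧ (-c*s5)^4=(a*s0)^4)) : False := by
  have hbc : b^4 = c^4 := by linear_combination (b^2-c^2)*hr
  have hab : a^2 ≠ b^2 := fun h => hr' (by linear_combination (a^2+b^2)*h)
  have hab' : a^2 ≠ -b^2 := fun h => hr' (by linear_combination (a^2-b^2)*h)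
  unfold M15 F4 at hs ht
  rcases hs with ⟨e1, ⟨e2, e3⟩ | ⟨e2, e3⟩ | ⟨e2, e3⟩⟩ | ⟨e1, ⟨e2, e3⟩ | ⟨e2, e3⟩ | ⟨e2, e3⟩⟩ | ⟨e1, ⟨e2, e3⟩ | ⟨e2, e3⟩ | ⟨e2, e3⟩⟩ | ⟨e1, ⟨e2, e3⟩ | ⟨e2, e3⟩ | ⟨e2, e3⟩⟩ | ⟨e1, ⟨e2, e3⟩ | ⟨e2, e3⟩ | ⟨e2, e3⟩⟩ <;>
  (rw [add_comm] at e1 e2 e3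
   replace e1 := eq_neg_of_add_eq_zero_left e1
   replace e2 := eq_neg_of_add_eq_zero_left e2
   replace e3 := eq_neg_of_add_eq_zero_left e3
   subst e1 e2 e3
   rcases ht with ⟨f1, ⟨f2, f3⟩ | ⟨f2, f3⟩ | ⟨f2, f3⟩⟩ | ⟨f1, ⟨f2, f3⟩ | ⟨f2, f3⟩ | ⟨f2, f3⟩⟩ | ⟨f1, ⟨f2, f3⟩ | ⟨f2, f3⟩ | ⟨f2, f3⟩⟩ | ⟨f1, ⟨f2, f3⟩ | ⟨f2, f3⟩ | ⟨f2, f3⟩⟩ | ⟨f1, ⟨f2, f3⟩ | ⟨f2, f3⟩ | ⟨f2, f3⟩⟩ <;> grind)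
/-- Unimodular vectors summing to zero in which every entry has an opposite one. -/
def Good (v : Fin 6 → ℂ) : Prop := (∀ k, ‖v k‖ = 1) ∧ ∑ k, v k = 0 ∧ ∀ k, ∃ l, v k + v l = 0

/-- All fourth powers agree. -/
def Sp (v : Fin 6 → ℂ) : Prop := ∀ k l, v k ^ 4 = v l ^ 4

/-- The normal form of a special row. -/
noncomputable def EE : Fin 6 → ℂ :=
  ![1, -1, Complex.I, Complex.I, -Complex.I, -Complex.I]

/-- `v` is, up to order and scaling, the special row. -/
def NF (v : Fin 6 → ℂ) : Prop := ∃ (τ : Equiv.Perm (Fin 6)) (x : ℂ), ∀ k, v (τ k) = x * EE k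

lemma unit_conj (z : ℂ) (hz : ‖z‖ = 1) : z * (starRingEnd ℂ) z = 1 := by
  rw [Complex.mul_conj, Complex.normSq_eq_norm_sq, hz]; simp

lemma unit_ne (z : ℂ) (hz : ‖z‖ = 1) : z ≠ 0 := by
  rintro rfl; simp at hz

lemma Good.comp {v : Fin 6 → ℂ} (h : Good v) (τ : Equiv.Perm (Fin 6)) :
    Good (fun k => v (τ k)) := by
  refine ⟨fun k => h.1 _, ?_, fun k => ?_⟩
  · rw [← h.2.1]; exact Equiv.sum_comp τ v
  · obtain ⟨l, hl⟩ := h.2.2 (τ k)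
    exact ⟨τ.symm l, by simpa using hl⟩

lemma Good.conj {v : Fin 6 → ℂ} (h : Good v) : Good (fun k => (starRingEnd ℂ) (v k)) := by
  refine ⟨fun k => by simpa using h.1 k, ?_, fun k => ?_⟩
  · rw [← map_sum, h.2.1, map_zero]
  · obtain ⟨l, hl⟩ := h.2.2 k
    exact ⟨l, by rw [← map_add, hl, map_zero]⟩

lemma m15_of_opp {v : Fin 6 → ℂ} (hu : ∀ k, ‖v k‖ = 1) (hs : ∑ k, v k = 0)
    (hp : ∃ l, v 0 + v l = 0) : M15 (v 0) (v 1) (v 2) (v 3) (v 4) (v 5) := by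
  obtain ⟨l, hl⟩ := hp
  rw [Fin.sum_univ_six] at hs
  unfold M15
  fin_cases l
  · exfalso
    have := unit_ne _ (hu 0)
    simp at hl
    exact this hl
  · replace hl : v 0 + v 1 = 0 := hl
    exact Or.inl (⟨hl, four _ _ _ _ (hu _) (hu _) (hu _) (hu _)
      (by linear_combination hs - hl)⟩)
  · replace hl : v 0 + v 2 = 0 := hl
    exact Or.inr (Or.inl (⟨hl, four _ _ _ _ (hu _) (hu _) (hu _) (hu _)
      (by linear_combination hs - hl)⟩))
  · replace hl : v 0 + v 3 = 0 := hl
    exact Or.inr (Or.inr (Or.inl (⟨hl, four _ _ _ _ (hu _) (hu _) (hu _) (hu _)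
      (by linear_combination hs - hl)⟩)))
  · replace hl : v 0 + v 4 = 0 := hl
    exact Or.inr (Or.inr (Or.inr (Or.inl (⟨hl, four _ _ _ _ (hu _) (hu _) (hu _) (hu _)
      (by linear_combination hs - hl)⟩))))
  · replace hl : v 0 + v 5 = 0 := hl
    exact Or.inr (Or.inr (Or.inr (Or.inr (⟨hl, four _ _ _ _ (hu _) (hu _) (hu _) (hu _)
      (by linear_combination hs - hl)⟩))))

lemma Good.m15 {v : Fin 6 → ℂ} (h : Good v) :
    M15 (v 0) (v 1) (v 2) (v 3) (v 4) (v 5) := m15_of_opp h.1 h.2.1 (h.2.2 0)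

lemma exists_perm (k l : Fin 6) (h : k ≠ l) :
    ∃ τ : Equiv.Perm (Fin 6), τ 0 = k ∧ τ 1 = l := by
  refine ⟨Equiv.swap (Equiv.swap 0 k 1) l * Equiv.swap 0 k, ?_, ?_⟩
  · revert k l; decide
  · revert k l; decide

lemma Good.normal {v : Fin 6 → ℂ} (h : Good v) (k : Fin 6) :
    ∃ τ : Equiv.Perm (Fin 6), τ 0 = k ∧ v (τ 1) = -v (τ 0) ∧ v (τ 3) = - v (τ 2) ∧
      v (τ 5) = - v (τ 4) := by
  obtain ⟨l, hl⟩ := h.2.2 k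
  have hkl : k ≠ l := by
    rintro rfl
    have := unit_ne _ (h.1 k)
    simp at hl
    exact this hl
  obtain ⟨τ, h0, h1⟩ := exists_perm k l hkl
  have g := h.comp τ
  have hs := g.2.1
  rw [Fin.sum_univ_six] at hs
  rw [← h0, ← h1] at hl
  have key := four _ _ _ _ (h.1 (τ 2)) (h.1 (τ 3)) (h.1 (τ 4)) (h.1 (τ 5))
    (by linear_combination hs - hl)
  rcases key with ⟨e, f⟩ | ⟨e, f⟩ | ⟨e, f⟩
  · exact ⟨τ, h0, by linear_combination hl, by linear_combination e, by linear_combination f⟩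
  · refine ⟨τ * Equiv.swap 3 4, ?_, ?_, ?_, ?_⟩
    · exact h0
    · change v (τ 1) = - v (τ 0); linear_combination hl
    · change v (τ 4) = - v (τ 2); linear_combination e
    · change v (τ 5) = - v (τ 3); linear_combination f
  · refine ⟨τ * Equiv.swap 3 5, ?_, ?_, ?_, ?_⟩
    · exact h0
    · change v (τ 1) = - v (τ 0); linear_combination hl
    · change v (τ 5) = - v (τ 2); linear_combination e
    · change v (τ 3) = - v (τ 4); linear_combination f

lemma triple {r s : Fin 6 → ℂ} (hr : Good r) (hs : Good s)
    (ht : Good (fun k => r k * (starRingEnd ℂ) (s k))) (τ : Equiv.Perm (Fin 6))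
    (h1 : r (τ 1) = - r (τ 0)) (h3 : r (τ 3) = - r (τ 2)) (h5 : r (τ 5) = - r (τ 4)) :
    (r (τ 0))^2 + (r (τ 2))^2 = 0 ∨ (r (τ 2))^2 + (r (τ 4))^2 = 0 ∨
      (r (τ 0))^2 + (r (τ 4))^2 = 0 := by
  have hs' := hs.conj.comp τ
  have ht' := (ht.comp τ).m15
  simp only [h1, h3, h5] at ht'
  exact lemA _ _ _ _ _ _ _ _ _ (unit_ne _ (hr.1 _)) (unit_ne _ (hr.1 _)) (unit_ne _ (hr.1 _))
    (unit_ne _ (hs'.1 0)) (unit_ne _ (hs'.1 1)) (unit_ne _ (hs'.1 2)) (unit_ne _ (hs'.1 3))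
    (unit_ne _ (hs'.1 4)) (unit_ne _ (hs'.1 5)) hs'.m15 ht'

open Classical in
/-- The odd columns of a row. -/
noncomputable def OO (v : Fin 6 → ℂ) : Finset (Fin 6) :=
  Finset.univ.filter (fun k => 2 * (v k)^2 = ∑ l, (v l)^2)

lemma mem_OO (v : Fin 6 → ℂ) (k : Fin 6) : k ∈ OO v ↔ 2 * (v k)^2 = ∑ l, (v l)^2 := by
  simp [OO]

lemma card_OO {r s : Fin 6 → ℂ} (hr : Good r) (hs : Good s)
    (ht : Good (fun k => r k * (starRingEnd ℂ) (s k))) : 2 ≤ (OO r).card := by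
  obtain ⟨τ, -, h1, h3, h5⟩ := hr.normal 0
  have hsum : ∑ l, (r l)^2 = 2 * ((r (τ 0))^2 + (r (τ 2))^2 + (r (τ 4))^2) := by
    rw [← Equiv.sum_comp τ, Fin.sum_univ_six, h1, h3, h5]; ring
  have key : ∀ k l : Fin 6, k ≠ l → τ k ∈ OO r → τ l ∈ OO r → 2 ≤ (OO r).card := by
    intro k l hkl hk hl
    have : ({τ k, τ l} : Finset (Fin 6)) ⊆ OO r := by
      intro x hx
      simp only [Finset.mem_insert, Finset.mem_singleton] at hx
      rcases hx with rfl | rfl <;> assumption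
    rw [← Finset.card_pair (fun h => hkl (τ.injective h))]
    exact Finset.card_le_card this
  rcases triple hr hs ht τ h1 h3 h5 with h | h | h
  · refine key 4 5 (by decide) ?_ ?_ <;> rw [mem_OO, hsum] <;> try rw [h5]
    all_goals linear_combination -2 * h
  · refine key 0 1 (by decide) ?_ ?_ <;> rw [mem_OO, hsum] <;> try rw [h1]
    all_goals linear_combination -2 * h
  · refine key 2 3 (by decide) ?_ ?_ <;> rw [mem_OO, hsum] <;> try rw [h3]
    all_goals linear_combination -2 * h

lemma disj_OO {r s : Fin 6 → ℂ} (hr : Good r) (hs : Good s)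
    (ht : Good (fun k => r k * (starRingEnd ℂ) (s k)))
    (nr : ¬ Sp r) (ns : ¬ Sp s) (nt : ¬ Sp (fun k => r k * (starRingEnd ℂ) (s k))) :
    Disjoint (OO r) (OO s) := by
  rw [Finset.disjoint_left]
  intro k hkr hks
  rw [mem_OO] at hkr hks
  obtain ⟨τ, h0, h1, h3, h5⟩ := hr.normal k
  have lift : ∀ w : Fin 6 → ℂ, ((w (τ 1))^4 = (w (τ 0))^4 ∧ (w (τ 2))^4 = (w (τ 0))^4 ∧
      (w (τ 3))^4 = (w (τ 0))^4 ∧ (w (τ 4))^4 = (w (τ 0))^4 ∧ (w (τ 5))^4 = (w (τ 0))^4) →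
      Sp w := by
    rintro w ⟨a1, a2, a3, a4, a5⟩
    have : ∀ k, w (τ k)^4 = w (τ 0)^4 := by
      intro k; fin_cases k
      · rfl
      all_goals assumption
    intro k l
    have hk := this (τ.symm k)
    have hl := this (τ.symm l)
    simp only [Equiv.apply_symm_apply] at hk hl
    rw [hk, hl]
  have hsum : ∑ l, (r l)^2 = 2 * ((r (τ 0))^2 + (r (τ 2))^2 + (r (τ 4))^2) := by
    rw [← Equiv.sum_comp τ, Fin.sum_univ_six, h1, h3, h5]; ring
  have hbc : (r (τ 2))^2 + (r (τ 4))^2 = 0 := by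
    rw [hsum, ← h0] at hkr
    linear_combination -hkr / 2
  have hs' := hs.conj.comp τ
  have ht' := (ht.comp τ).m15
  simp only [h1, h3, h5] at ht'
  refine lemB _ _ _ _ _ _ _ _ _ (unit_ne _ (hr.1 _)) (unit_ne _ (hr.1 _)) (unit_ne _ (hr.1 _))
    (unit_ne _ (hs'.1 0)) (unit_ne _ (hs'.1 1)) (unit_ne _ (hs'.1 2)) (unit_ne _ (hs'.1 3))
    (unit_ne _ (hs'.1 4)) (unit_ne _ (hs'.1 5)) hs'.m15 ht' hbc ?_ ?_ ?_ ?_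
  · intro hab
    apply nr
    apply lift
    rw [h1, h3, h5]
    refine ⟨by ring, by rw [hab], by rw [hab]; ring, ?_, ?_⟩
    · linear_combination -hab - (r (τ 2)^2 - r (τ 4)^2) * hbc
    · linear_combination -hab - (r (τ 2)^2 - r (τ 4)^2) * hbc
  · rw [← Equiv.sum_comp τ, Fin.sum_univ_six, ← h0] at hks
    have := congrArg (starRingEnd ℂ) hks
    simpa only [map_mul, map_add, map_pow, Complex.conj_ofNat] using this
  · rintro hcon
    apply ns
    apply lift
    have inj : ∀ x y : ℂ, ((starRingEnd ℂ) x)^4 = ((starRingEnd ℂ) y)^4 → x^4 = y^4 := by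
      intro x y h
      rw [← map_pow, ← map_pow] at h
      exact (starRingEnd ℂ).injective h
    obtain ⟨a1, a2, a3, a4, a5⟩ := hcon
    exact ⟨inj _ _ a1, inj _ _ a2, inj _ _ a3, inj _ _ a4, inj _ _ a5⟩
  · intro hcon
    apply nt
    apply lift
    simp only [h1, h3, h5]
    exact hcon

lemma nf_comp {v : Fin 6 → ℂ} (π : Equiv.Perm (Fin 6)) (h : NF (fun k => v (π k))) : NF v := by
  obtain ⟨τ, x, hx⟩ := h
  exact ⟨π * τ, x, hx⟩

lemma nf1 (v : Fin 6 → ℂ) (h1 : v 1 = - v 0) (h2 : v 2 = Complex.I * v 0) (h3 : v 3 = - v 2)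
    (h5 : v 5 = - v 4) (h4 : v 4 ^ 4 = v 0 ^ 4) : NF v := by
  have I2 := Complex.I_sq
  have : (v 4 - v 0) * ((v 4 + v 0) * ((v 4 - Complex.I * v 0) * (v 4 + Complex.I * v 0))) = 0 := by
    linear_combination h4 - (v 4^2 * v 0^2 - v 0^4) * I2
  have bld : ∀ (f : Fin 6 → Fin 6) (hf : Function.Bijective f) (x : ℂ),
      (∀ k, v (f k) = x * EE k) → NF v := fun f hf x hx => ⟨Equiv.ofBijective f hf, x, hx⟩
  rcases mul_eq_zero.1 this with h | h
  · have h' : v 4 = v 0 := by linear_combination h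
    refine bld ![2, 3, 1, 5, 0, 4] (by decide) (Complex.I * v 0) ?_
    intro k
    fin_cases k <;> simp [EE, h1, h2, h3, h5, h'] <;> grind
  rcases mul_eq_zero.1 h with h | h
  · have h' : v 4 = - v 0 := by linear_combination h
    refine bld ![2, 3, 1, 4, 0, 5] (by decide) (Complex.I * v 0) ?_
    intro k
    fin_cases k <;> simp [EE, h1, h2, h3, h5, h'] <;> grind
  rcases mul_eq_zero.1 h with h | h
  · have h' : v 4 = Complex.I * v 0 := by linear_combination h
    refine bld ![0, 1, 2, 4, 3, 5] (by decide) (v 0) ?_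
    intro k
    fin_cases k <;> simp [EE, h1, h2, h3, h5, h'] <;> ring
  · have h' : v 4 = - (Complex.I * v 0) := by linear_combination h
    refine bld ![0, 1, 2, 5, 3, 4] (by decide) (v 0) ?_
    intro k
    fin_cases k <;> simp [EE, h1, h2, h3, h5, h'] <;> ring

lemma nf2 (v : Fin 6 → ℂ) (h1 : v 1 = - v 0) (h2 : v 0 ^ 2 + v 2 ^ 2 = 0) (h3 : v 3 = - v 2)
    (h5 : v 5 = - v 4) (h4 : v 4 ^ 4 = v 0 ^ 4) : NF v := by
  have I2 := Complex.I_sq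
  have : (v 2 - Complex.I * v 0) * (v 2 + Complex.I * v 0) = 0 := by
    linear_combination h2 - v 0 ^ 2 * I2
  rcases mul_eq_zero.1 this with h | h
  · exact nf1 v h1 (by linear_combination h) h3 h5 h4
  · apply nf_comp (Equiv.swap 2 3)
    apply nf1
    · exact h1
    · change v 3 = Complex.I * v 0
      rw [h3]; linear_combination -h
    · change v 2 = - v 3
      rw [h3]; ring
    · exact h5
    · exact h4

lemma nf_of_special {r s : Fin 6 → ℂ} (hr : Good r) (hs : Good s)
    (ht : Good (fun k => r k * (starRingEnd ℂ) (s k))) (hsp : Sp r) : NF r := by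
  obtain ⟨τ, -, h1, h3, h5⟩ := hr.normal 0
  apply nf_comp τ
  rcases triple hr hs ht τ h1 h3 h5 with h | h | h
  · exact nf2 _ h1 h h3 h5 (hsp _ _)
  · apply nf_comp (Equiv.swap 0 4 * Equiv.swap 1 5)
    apply nf2
    · exact h5
    · change r (τ 4) ^ 2 + r (τ 2) ^ 2 = 0
      linear_combination h
    · exact h3
    · exact h1
    · exact hsp _ _
  · apply nf_comp (Equiv.swap 2 4 * Equiv.swap 3 5)
    apply nf2
    · exact h1
    · exact h
    · exact h5
    · exact h3
    · exact hsp _ _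

/-- Entrywise product of row `i` with the conjugate of row `j`. -/
def fr (h : Matrix (Fin 6) (Fin 6) ℂ) (i j k : Fin 6) : ℂ := h i k * (starRingEnd ℂ) (h j k)

lemma good_fr (h : Matrix (Fin 6) (Fin 6) ℂ) (hH : IsCHM h) (i j : Fin 6) (hij : i ≠ j)
    (hb : BinaryPair h i j) : Good (fr h i j) := by
  refine ⟨fun k => ?_, hH.2 i j hij, fun k => ?_⟩
  · simp [fr, hH.1]
  · obtain ⟨x, y, z, -, -, -, hm⟩ := hb
    have h1 : ∀ w : ℂ, w ∈ rowProd h i j ↔ ∃ l, fr h i j l = w := by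
      intro w
      simp only [rowProd, Multiset.mem_map, Finset.mem_val, Finset.mem_univ, true_and, fr]
    have h2 : fr h i j k ∈ rowProd h i j := (h1 _).2 ⟨k, rfl⟩
    have h3 : - fr h i j k ∈ rowProd h i j := by
      rw [hm] at h2 ⊢
      simp only [Multiset.insert_eq_cons, Multiset.mem_cons, Multiset.mem_singleton] at h2 ⊢
      rcases h2 with h | h | h | h | h | h <;> rw [h] <;> simp
    obtain ⟨l, hl⟩ := (h1 _).1 h3
    exact ⟨l, by rw [hl]; ring⟩

lemma fr_mul (h : Matrix (Fin 6) (Fin 6) ℂ) (hH : IsCHM h) (i j l : Fin 6) :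
    (fun k => fr h i j k * (starRingEnd ℂ) (fr h l j k)) = fr h i l := by
  funext k
  simp only [fr, map_mul, Complex.conj_conj]
  linear_combination (h i k * (starRingEnd ℂ) (h l k)) * unit_conj _ (hH.1 j k)

lemma exists_special (h : Matrix (Fin 6) (Fin 6) ℂ) (hH : IsCHM h)
    (hg : ∀ i j : Fin 6, i ≠ j → Good (fr h i j)) : ∃ i j : Fin 6, i ≠ j ∧ Sp (fr h i j) := by
  by_contra hcon
  push Not at hcon
  have hc : ∀ i : Fin 6, i ≠ 0 → 2 ≤ (OO (fr h i 0)).card := by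
    intro i hi
    obtain ⟨l, hl0, hli⟩ : ∃ l : Fin 6, l ≠ 0 ∧ i ≠ l := by revert i; decide
    refine card_OO (hg i 0 hi) (hg l 0 hl0) ?_
    rw [fr_mul h hH]
    exact hg i l hli
  have hd : ∀ i l : Fin 6, i ≠ 0 → l ≠ 0 → i ≠ l →
      Disjoint (OO (fr h i 0)) (OO (fr h l 0)) := by
    intro i l hi hl hil
    refine disj_OO (hg i 0 hi) (hg l 0 hl) ?_ (hcon i 0 hi) (hcon l 0 hl) ?_
    · rw [fr_mul h hH]; exact hg i l hil
    · rw [fr_mul h hH]; exact hcon i l hil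
  have h1 : ((Finset.univ.erase (0 : Fin 6)).biUnion (fun i => OO (fr h i 0))).card =
      ∑ i ∈ Finset.univ.erase (0 : Fin 6), (OO (fr h i 0)).card := by
    apply Finset.card_biUnion
    intro i hi l hl hil
    exact hd i l (Finset.ne_of_mem_erase hi) (Finset.ne_of_mem_erase hl) hil
  have h2 : ∑ i ∈ Finset.univ.erase (0 : Fin 6), 2 ≤
      ∑ i ∈ Finset.univ.erase (0 : Fin 6), (OO (fr h i 0)).card :=
    Finset.sum_le_sum (fun i hi => hc i (Finset.ne_of_mem_erase hi))
  have h3 := Finset.card_le_univ ((Finset.univ.erase (0 : Fin 6)).biUnion (fun i => OO (fr h i 0)))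
  rw [h1] at h3
  have h4 : ∑ i ∈ Finset.univ.erase (0 : Fin 6), 2 = 10 := by decide
  rw [h4] at h2
  simp at h3
  omega

lemma sum_cubes {v : Fin 6 → ℂ} (hv : Good v) : ∑ k, v k ^ 3 = 0 := by
  obtain ⟨τ, -, h1, h3, h5⟩ := hv.normal 0
  rw [← Equiv.sum_comp τ, Fin.sum_univ_six, h1, h3, h5]; ring

lemma two_units (a b S : ℂ) (ha : ‖a‖ = 1) (hb : ‖b‖ = 1) (h : a + b = S) :
    a * b * (starRingEnd ℂ) S = S := by
  rw [← h, map_add]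
  linear_combination b * unit_conj a ha + a * unit_conj b hb

lemma polyC (i g : ℂ) (hi : i ^ 2 = -1) :
    (-((1 + i) + (1 - i) * g) / 2) ^ 3 * (-((1 - i) * g + (1 + i)) / 2)
      - 3 * (-((1 + i) + (1 - i) * g) / 2) ^ 2 * g
      - (-((1 - i) + (1 + i) * g ^ 3) / 2) * (-((1 - i) * g + (1 + i)) / 2)
      = -(3 / 4) * (g ^ 2 + 1) ^ 2 := by
  grind

/-- A row orthogonal (with cubes) to the special pair of rows: second entry. -/
lemma lemC (g a b c d : ℂ) (hg : ‖g‖ = 1) (ha : ‖a‖ = 1) (hb : ‖b‖ = 1)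
    (e1 : 1 + g + a + b + c + d = 0)
    (e2 : 1 - g - Complex.I * (a + b) + Complex.I * (c + d) = 0)
    (e3 : 1 + g ^ 3 + a ^ 3 + b ^ 3 + c ^ 3 + d ^ 3 = 0)
    (e4 : 1 - g ^ 3 + Complex.I * (a ^ 3 + b ^ 3) - Complex.I * (c ^ 3 + d ^ 3) = 0) :
    g = Complex.I ∨ g = -Complex.I := by
  have I2 := Complex.I_sq
  have hS : a + b = -((1 + Complex.I) + (1 - Complex.I) * g) / 2 := by
    linear_combination e1 / 2 + Complex.I / 2 * e2 + ((a + b) / 2 - (c + d) / 2) * I2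
  have hS3 : a ^ 3 + b ^ 3 = -((1 - Complex.I) + (1 + Complex.I) * g ^ 3) / 2 := by
    linear_combination e3 / 2 - Complex.I / 2 * e4
      + ((a ^ 3 + b ^ 3) / 2 - (c ^ 3 + d ^ 3) / 2) * I2
  have hP := two_units a b _ ha hb hS
  have hSb : (starRingEnd ℂ) (-((1 + Complex.I) + (1 - Complex.I) * g) / 2) * g =
      -((1 - Complex.I) * g + (1 + Complex.I)) / 2 := by
    simp only [map_div₀, map_neg, map_add, map_mul, map_sub, map_one, Complex.conj_I,
      Complex.conj_ofNat]
    linear_combination -(1 + Complex.I) / 2 * unit_conj g hg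
  generalize (starRingEnd ℂ) (-((1 + Complex.I) + (1 - Complex.I) * g) / 2) = Sb at hP hSb
  have hc : (a + b) ^ 3 - 3 * (a * b) * (a + b) = a ^ 3 + b ^ 3 := by ring
  rw [hS, hS3] at hc
  have hfin : (g ^ 2 + 1) ^ 2 = 0 := by
    have hE := polyC Complex.I g I2
    rw [← hSb] at hE
    linear_combination 4 / 3 * hE - 4 / 3 * Sb * g * hc
      - 4 * (-((1 + Complex.I) + (1 - Complex.I) * g) / 2) * g * hP
  have h0 : (g - Complex.I) * (g + Complex.I) = 0 := by
    have := pow_eq_zero_iff (two_ne_zero) |>.1 hfin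
    linear_combination this - I2
  rcases mul_eq_zero.1 h0 with h | h
  · left; linear_combination h
  · right; linear_combination h

lemma lemC1 (a b c d : ℂ) (ha : ‖a‖ = 1) (hb : ‖b‖ = 1) 
    (e1 : 1 + Complex.I + a + b + c + d = 0)
    (e2 : 1 - Complex.I - Complex.I * (a + b) + Complex.I * (c + d) = 0) :
    d = -c ∧ ((a = -1 ∧ b = -Complex.I) ∨ (a = -Complex.I ∧ b = -1)) := by
  have I2 := Complex.I_sq
  have hS : a + b = -(1 + Complex.I) := by
    linear_combination e1 / 2 + Complex.I / 2 * e2 + ((a + b) / 2 - (c + d) / 2 + 1 / 2) * I2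
  have hT : d = -c := by linear_combination e1 - hS
  refine ⟨hT, ?_⟩
  have hP := two_units a b _ ha hb hS
  simp only [map_neg, map_add, map_one, Complex.conj_I] at hP
  have hP' : a * b = Complex.I := by
    linear_combination -(1 + Complex.I) / 2 * hP + (1 + a * b) / 2 * I2
  have : (a + 1) * (a + Complex.I) = 0 := by linear_combination a * hS - hP'
  rcases mul_eq_zero.1 this with h | h
  · left; exact ⟨by linear_combination h, by linear_combination hS - h⟩
  · right; exact ⟨by linear_combination h, by linear_combination hS - h⟩

lemma lemC2 (a b c d : ℂ) (hc : ‖c‖ = 1) (hd : ‖d‖ = 1)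
    (e1 : 1 - Complex.I + a + b + c + d = 0)
    (e2 : 1 + Complex.I - Complex.I * (a + b) + Complex.I * (c + d) = 0) :
    b = -a ∧ ((c = Complex.I ∧ d = -1) ∨ (c = -1 ∧ d = Complex.I)) := by
  have I2 := Complex.I_sq
  have hS : c + d = -(1 - Complex.I) := by
    linear_combination e1 / 2 - Complex.I / 2 * e2 - ((a + b) / 2 - (c + d) / 2 - 1 / 2) * I2
  have hT : b = -a := by linear_combination e1 - hS
  refine ⟨hT, ?_⟩
  have hP := two_units c d _ hc hd hS
  simp only [map_neg, map_sub, map_one, Complex.conj_I] at hP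
  have hP' : c * d = -Complex.I := by
    linear_combination -(1 - Complex.I) / 2 * hP + (1 + c * d) / 2 * I2
  have : (c + 1) * (c - Complex.I) = 0 := by linear_combination c * hS - hP'
  rcases mul_eq_zero.1 this with h | h
  · right; exact ⟨by linear_combination h, by linear_combination hS - h⟩
  · left; exact ⟨by linear_combination h, by linear_combination hS - h⟩

/-- Row `i` of `G` plays the role of row `c` of the Haagerup matrix. -/
def QQ (G : Fin 6 → Fin 6 → ℂ) (i0 i1 : Fin 6) (c i : Fin 6) : Prop :=
  match c with
  | 0 => i = i0
  | 1 => i = i1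
  | 2 => G i 1 = Complex.I ∧ G i 2 = -1 ∧ G i 3 = -Complex.I ∧ G i 5 = -G i 4
  | 3 => G i 1 = Complex.I ∧ G i 2 = -Complex.I ∧ G i 3 = -1 ∧ G i 5 = -G i 4
  | 4 => G i 1 = -Complex.I ∧ G i 4 = Complex.I ∧ G i 5 = -1 ∧ G i 3 = -G i 2
  | 5 => G i 1 = -Complex.I ∧ G i 4 = -1 ∧ G i 5 = Complex.I ∧ G i 3 = -G i 2

lemma no_two (p p' : ℂ) (hp : ‖p‖ = 1) (hp' : ‖p'‖ = 1)
    (h : 4 + 2 * (p * (starRingEnd ℂ) p') = 0) : False := by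
  have h1 : p * (starRingEnd ℂ) p' = -2 := by linear_combination h / 2
  have h2 := congrArg norm h1
  simp [hp, hp'] at h2

lemma final (G : Fin 6 → Fin 6 → ℂ) (i0 i1 : Fin 6) (hu : ∀ i k, ‖G i k‖ = 1)
    (h0 : ∀ i, G i 0 = 1) (hi0 : ∀ k, G i0 k = 1) (hi1 : ∀ k, G i1 k = EE k)
    (ho : ∀ i j, i ≠ j → ∑ k, G i k * (starRingEnd ℂ) (G j k) = 0)
    (ho3 : ∀ i j, i ≠ j → ∑ k, (G i k * (starRingEnd ℂ) (G j k)) ^ 3 = 0) :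
    ∃ (σ : Equiv.Perm (Fin 6)) (q : ℂ), ‖q‖ = 1 ∧ ∀ c j, HaagM q c j = G (σ c) j := by
  have I2 := Complex.I_sq
  have hex : ∀ i, ∃ c, QQ G i0 i1 c i := by
    intro i
    by_cases e0 : i = i0
    · exact ⟨0, e0⟩
    by_cases e1 : i = i1
    · exact ⟨1, e1⟩
    have a1 := ho i i0 e0
    have a2 := ho i i1 e1
    have a3 := ho3 i i0 e0
    have a4 := ho3 i i1 e1
    simp [Fin.sum_univ_six, hi0, hi1, EE, h0] at a1 a2 a3 a4
    have I3 : Complex.I ^ 3 = -Complex.I := by rw [pow_succ, I2]; ring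
    have b2 : 1 - G i 1 - Complex.I * (G i 2 + G i 3) + Complex.I * (G i 4 + G i 5) = 0 := by
      linear_combination a2
    have b4 : 1 - G i 1 ^ 3 + Complex.I * (G i 2 ^ 3 + G i 3 ^ 3)
        - Complex.I * (G i 4 ^ 3 + G i 5 ^ 3) = 0 := by
      linear_combination a4 + (G i 2 ^ 3 + G i 3 ^ 3 - G i 4 ^ 3 - G i 5 ^ 3) * I3
    rcases lemC _ _ _ _ _ (hu i 1) (hu i 2) (hu i 3) a1 b2 a3 b4 with h | h
    · rw [h] at a1 b2
      obtain ⟨c1, ⟨c2, c3⟩ | ⟨c2, c3⟩⟩ := lemC1 _ _ _ _ (hu i 2) (hu i 3) a1 b2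
      · exact ⟨2, h, c2, c3, c1⟩
      · exact ⟨3, h, c2, c3, c1⟩
    · rw [h] at a1 b2
      obtain ⟨c1, ⟨c2, c3⟩ | ⟨c2, c3⟩⟩ := lemC2 (G i 2) (G i 3) (G i 4) (G i 5) (hu i 4) (hu i 5)
        (by linear_combination a1) (by linear_combination b2)
      · exact ⟨4, h, c2, c3, c1⟩
      · exact ⟨5, h, c2, c3, c1⟩
  choose cls hcls using hex
  have hinj : Function.Injective cls := by
    intro i j hij
    by_contra hne
    have o := ho i j hne
    rw [Fin.sum_univ_six, h0, h0] at o
    have hi := hcls i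
    have hj := hcls j
    rw [← hij] at hj
    generalize cls i = c at hi hj
    fin_cases c
    · exact hne ((show i = i0 from hi).trans (show j = i0 from hj).symm)
    · exact hne ((show i = i1 from hi).trans (show j = i1 from hj).symm)
    all_goals
      obtain ⟨x1, x2, x3, x4⟩ := hi
      obtain ⟨y1, y2, y3, y4⟩ := hj
      rw [x1, x2, x3, x4, y1, y2, y3, y4] at o
      simp only [map_neg, map_one, Complex.conj_I] at o
    · exact no_two _ _ (hu i 4) (hu j 4) (by linear_combination o + 2 * I2)
    · exact no_two _ _ (hu i 4) (hu j 4) (by linear_combination o + 2 * I2)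
    · exact no_two _ _ (hu i 2) (hu j 2) (by linear_combination o + 2 * I2)
    · exact no_two _ _ (hu i 2) (hu j 2) (by linear_combination o + 2 * I2)
  let e : Equiv.Perm (Fin 6) := Equiv.ofBijective cls (Finite.injective_iff_bijective.1 hinj)
  have hσ : ∀ c, QQ G i0 i1 c (e.symm c) := by
    intro c
    have h := hcls (e.symm c)
    have h' : cls (e.symm c) = c := e.apply_symm_apply c
    rwa [h'] at h
  have hne : ∀ c d : Fin 6, c ≠ d → e.symm c ≠ e.symm d := fun c d h h' => h (e.symm.injective h')
  generalize e.symm = σ at hσ hne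
  refine ⟨σ, G (σ 2) 4, hu _ _, ?_⟩
  have q0 : σ 0 = i0 := hσ 0
  have q1 : σ 1 = i1 := hσ 1
  obtain ⟨p1, p2, p3, p4⟩ := hσ 2
  obtain ⟨r1, r2, r3, r4⟩ := hσ 3
  obtain ⟨s1, s2, s3, s4⟩ := hσ 4
  obtain ⟨t1, t2, t3, t4⟩ := hσ 5
  have o3 := ho _ _ (hne 3 2 (by decide))
  have o4 := ho _ _ (hne 4 2 (by decide))
  have o5 := ho _ _ (hne 5 2 (by decide))
  rw [Fin.sum_univ_six, h0, h0] at o3 o4 o5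
  rw [p1, p2, p3, p4, r1, r2, r3, r4] at o3
  rw [p1, p2, p3, p4, s1, s2, s3, s4] at o4
  rw [p1, p2, p3, p4, t1, t2, t3, t4] at o5
  simp only [map_neg, map_one, Complex.conj_I] at o3 o4 o5
  have hq := unit_conj _ (hu (σ 2) 4)
  have hI : (1 + Complex.I) ≠ 0 := by
    intro h
    have := congrArg Complex.re h
    simp at this
  have k3 : G (σ 3) 4 = - G (σ 2) 4 := by
    linear_combination G (σ 2) 4 / 2 * o3 - G (σ 3) 4 * hq + G (σ 2) 4 / 2 * I2
  have k4 : G (σ 4) 2 = (starRingEnd ℂ) (G (σ 2) 4) := by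
    apply mul_left_cancel₀ hI
    linear_combination -o4 + I2
  have k5 : G (σ 5) 2 = - (starRingEnd ℂ) (G (σ 2) 4) := by
    apply mul_left_cancel₀ hI
    linear_combination -o5 + I2
  intro c j
  fin_cases c <;> fin_cases j <;>
    simp [HaagM, q0, q1, hi0, hi1, EE, h0, p1, p2, p3, p4, r1, r2, r3, r4, s1, s2, s3, s4,
      t1, t2, t3, t4, k3, k4, k5]

lemma forward (h : Matrix (Fin 6) (Fin 6) ℂ) (hH : IsCHM h)
    (hb : ∀ i₁ i₂ : Fin 6, i₁ ≠ i₂ → BinaryPair h i₁ i₂) :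
    ∃ q : ℂ, ‖q‖ = 1 ∧ MatEquiv h (HaagM q) := by
  have hg : ∀ i j : Fin 6, i ≠ j → Good (fr h i j) := fun i j hij => good_fr h hH i j hij (hb i j hij)
  obtain ⟨i1, i0, h10, hsp⟩ := exists_special h hH hg
  obtain ⟨l, hl0, hl1⟩ : ∃ l : Fin 6, l ≠ i0 ∧ i1 ≠ l := by
    clear hsp; revert i1 i0; decide
  obtain ⟨τ, x, hx⟩ := nf_of_special (hg i1 i0 h10) (hg l i0 hl0)
    (by rw [fr_mul h hH]; exact hg i1 l hl1) hsp
  have hfu : ∀ i j k, ‖fr h i j k‖ = 1 := by intro i j k; simp [fr, hH.1]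
  let c : Fin 6 → ℂ := fun i => (starRingEnd ℂ) (fr h i i0 (τ 0))
  have hcu : ∀ i, ‖c i‖ = 1 := by intro i; simp [c, hfu]
  let G : Fin 6 → Fin 6 → ℂ := fun i k => c i * fr h i i0 (τ k)
  have hprod : ∀ i j k, G i k * (starRingEnd ℂ) (G j k) =
      (c i * (starRingEnd ℂ) (c j)) * fr h i j (τ k) := by
    intro i j k
    have := congrFun (fr_mul h hH i i0 j) (τ k)
    simp only [G, map_mul]
    linear_combination (c i * (starRingEnd ℂ) (c j)) * this
  have hself : ∀ k, fr h i0 i0 k = 1 := fun k => unit_conj _ (hH.1 _ _)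
  have hEE : EE 0 = 1 := rfl
  have hxu : x * (starRingEnd ℂ) x = 1 := by
    have h1 := hx 0
    rw [hEE, mul_one] at h1
    rw [← h1]
    exact unit_conj _ (hfu _ _ _)
  obtain ⟨σ, q, hq, hfin⟩ := final G i0 i1
    (by intro i k; simp [G, hcu, hfu])
    (by intro i; simp only [G, c]; rw [mul_comm]; exact unit_conj _ (hfu _ _ _))
    (by intro k; simp only [G, c, hself]; simp)
    (by
      intro k
      simp only [G, c, hx, hEE, mul_one]
      linear_combination EE k * hxu)
    (by
      intro i j hij
      simp only [hprod]
      rw [← Finset.mul_sum, ((hg i j hij).comp τ).2.1, mul_zero])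
    (by
      intro i j hij
      simp only [hprod, mul_pow]
      rw [← Finset.mul_sum, sum_cubes ((hg i j hij).comp τ), mul_zero])
  refine ⟨q, hq, σ, τ, fun i => c (σ i), fun j => (starRingEnd ℂ) (h i0 (τ j)),
    fun i => hcu _, fun j => by simp [hH.1], fun i j => ?_⟩
  rw [hfin]
  simp only [G, fr]
  ring

lemma bin_of_m15 (a b c d e f : ℂ) (h : M15 a b c d e f) (ha : ‖a‖ = 1) (hb : ‖b‖ = 1)
    (hc : ‖c‖ = 1) (hd : ‖d‖ = 1) (he : ‖e‖ = 1) (hf : ‖f‖ = 1) :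
    ∃ x y z : ℂ, ‖x‖ = 1 ∧ ‖y‖ = 1 ∧ ‖z‖ = 1 ∧
      ({a, b, c, d, e, f} : Multiset ℂ) = {x, -x, y, -y, z, -z} := by
  have key : ∀ x x' y y' z z' : ℂ, x + x' = 0 → y + y' = 0 → z + z' = 0 →
      ‖x‖ = 1 → ‖y‖ = 1 → ‖z‖ = 1 →
      ({a, b, c, d, e, f} : Multiset ℂ) = {x, x', y, y', z, z'} →
      ∃ x y z : ℂ, ‖x‖ = 1 ∧ ‖y‖ = 1 ∧ ‖z‖ = 1 ∧
      ({a, b, c, d, e, f} : Multiset ℂ) = {x, -x, y, -y, z, -z} := by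
    intro x x' y y' z z' h1 h2 h3 hx hy hz hm
    refine ⟨x, y, z, hx, hy, hz, ?_⟩
    rw [hm, eq_neg_of_add_eq_zero_right h1, eq_neg_of_add_eq_zero_right h2,
      eq_neg_of_add_eq_zero_right h3]
  unfold M15 F4 at h
  rcases h with ⟨e1, ⟨e2, e3⟩ | ⟨e2, e3⟩ | ⟨e2, e3⟩⟩ | ⟨e1, ⟨e2, e3⟩ | ⟨e2, e3⟩ | ⟨e2, e3⟩⟩ |
    ⟨e1, ⟨e2, e3⟩ | ⟨e2, e3⟩ | ⟨e2, e3⟩⟩ | ⟨e1, ⟨e2, e3⟩ | ⟨e2, e3⟩ | ⟨e2, e3⟩⟩ |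
    ⟨e1, ⟨e2, e3⟩ | ⟨e2, e3⟩ | ⟨e2, e3⟩⟩ <;>
  (refine key _ _ _ _ _ _ e1 e2 e3 (by assumption) (by assumption) (by assumption) ?_
   ext w
   simp only [Multiset.insert_eq_cons, Multiset.count_cons, Multiset.count_singleton] <;> ring)

/-- Every pair of rows of the Haagerup matrix has opposite products somewhere. -/
lemma haag_opp (q : ℂ) (hq : ‖q‖ = 1) (i j : Fin 6) (hij : i ≠ j) : ∃ l,
    HaagM q i 0 * (starRingEnd ℂ) (HaagM q j 0) +
      HaagM q i l * (starRingEnd ℂ) (HaagM q j l) = 0 := by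
  have I2 := Complex.I_sq
  have hqq := unit_conj q hq
  fin_cases i <;> fin_cases j <;> first
    | exact absurd rfl hij
    | (refine ⟨1, ?_⟩; simp [HaagM]; done)
    | (refine ⟨2, ?_⟩; simp [HaagM]; done)
    | (refine ⟨3, ?_⟩; simp [HaagM]; done)
    | (refine ⟨4, ?_⟩; simp [HaagM]; done)
    | (refine ⟨5, ?_⟩; simp [HaagM]; done)
    | (refine ⟨4, ?_⟩; simp [HaagM]; linear_combination -hqq)
    | (refine ⟨2, ?_⟩; simp [HaagM]; linear_combination -hqq)

lemma backward (h : Matrix (Fin 6) (Fin 6) ℂ) (hH : IsCHM h) (q : ℂ) (hq : ‖q‖ = 1)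
    (he : MatEquiv h (HaagM q)) (i₁ i₂ : Fin 6) (hne : i₁ ≠ i₂) : BinaryPair h i₁ i₂ := by
  obtain ⟨σ, τ, a, b, ha, hb, hk⟩ := he
  obtain ⟨i, rfl⟩ := σ.surjective i₁
  obtain ⟨j, rfl⟩ := σ.surjective i₂
  have hij : i ≠ j := fun e => hne (by rw [e])
  obtain ⟨l, hl⟩ := haag_opp q hq i j hij
  have hprod : ∀ k, HaagM q i k * (starRingEnd ℂ) (HaagM q j k) =
      (a i * (starRingEnd ℂ) (a j)) * fr h (σ i) (σ j) (τ k) := by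
    intro k
    rw [hk, hk]
    simp only [map_mul, fr]
    linear_combination (a i * h (σ i) (τ k) * (starRingEnd ℂ) (a j) *
      (starRingEnd ℂ) (h (σ j) (τ k))) * unit_conj _ (hb k)
  have hfu : ∀ k, ‖fr h (σ i) (σ j) (τ k)‖ = 1 := by intro k; simp [fr, hH.1]
  have hopp : fr h (σ i) (σ j) (τ 0) + fr h (σ i) (σ j) (τ l) = 0 := by
    rw [hprod, hprod, ← mul_add] at hl
    refine (mul_eq_zero.1 hl).resolve_left (unit_ne _ ?_)
    simp [ha]
  have hsum : ∑ k, fr h (σ i) (σ j) (τ k) = 0 := by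
    rw [Equiv.sum_comp τ (fr h (σ i) (σ j))]
    exact hH.2 _ _ hne
  have hm := m15_of_opp (v := fun k => fr h (σ i) (σ j) (τ k)) hfu hsum ⟨l, hopp⟩
  obtain ⟨x, y, z, hx, hy, hz, hxyz⟩ := bin_of_m15 _ _ _ _ _ _ hm (hfu _) (hfu _) (hfu _) (hfu _)
    (hfu _) (hfu _)
  refine ⟨x, y, z, hx, hy, hz, ?_⟩
  rw [← hxyz]
  have h1 : rowProd h (σ i) (σ j) =
      Multiset.map (fun k => fr h (σ i) (σ j) (τ k)) Finset.univ.val := by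
    conv_rhs => rw [← Function.comp_def (fr h (σ i) (σ j)) τ, ← Multiset.map_map,
      Multiset.map_univ_val_equiv]
    rfl
  rw [h1]
  rfl

/-- A 6×6 complex Hadamard matrix has all pairs of distinct rows binary
iff it is equivalent to the Haagerup matrix `H^q` for some unimodular `q`. -/
theorem stmt_15 (h : Matrix (Fin 6) (Fin 6) ℂ) (hH : IsCHM h) :
    (∀ i₁ i₂ : Fin 6, i₁ ≠ i₂ → BinaryPair h i₁ i₂) ↔
      ∃ q : ℂ, ‖q‖ = 1 ∧ MatEquiv h (HaagM q) := by
  exact ⟨fun hb => forward h hH hb, fun ⟨q, hq, he⟩ i₁ i₂ hne => backward h hH q hq he i₁ i₂ hne⟩
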